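/- Let R be a subalgebra of an affine integral domain S over an algebraically closed field k such that S is a depiction of R (U nonempty and contraction Max S → Max R surjective). Then dim_S R = trdeg_k Frac R = dim S, where dim_S R is the supremum of lengths of chains of distinct primes of R that lift to chains of primes of S. -/

import Mathlib

/-- The localization of a ring `T` at an ideal `M`, realized as a subset of `K` via
`f : T →+* K`. -/
def locSet {T K : Type*} [CommRing T] [CommRing K] (f : T →+* K) (M : Ideal T) : Set K :=
  {x | ∃ a b : T, b ∉ M ∧ x * f b = f a}

/-- An injective integral extension preserves the Krull dimension. -/
theorem ringKrullDim_eq_of_isIntegral (A B : Type*) [CommRing A] [CommRing B]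
    [Algebra A B] [FaithfulSMul A B] [Algebra.IsIntegral A B] :
    ringKrullDim A = ringKrullDim B := by
  apply le_antisymm
  · refine iSup_le fun l ↦ ?_
    obtain ⟨Q, _, _⟩ := (Ideal.nonempty_primesOver (S := B) l.head.asIdeal).some
    obtain ⟨L, hL, -⟩ := Ideal.exists_ltSeries_of_hasGoingUp l Q
    rw [← hL]
    exact Order.LTSeries.length_le_krullDim L
  · exact Order.krullDim_le_of_strictMono (PrimeSpectrum.comap (algebraMap A B))
      fun p q hpq ↦ Ideal.IsIntegral.comap_lt_comap hpq

open Cardinal in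
/-- The Krull dimension of an affine domain `A` is the cardinality of any transcendence basis of an
algebraic extension of `A`. -/
theorem IsTranscendenceBasis.ringKrullDim_eq {k A L ι : Type*} [Field k] [CommRing A] [IsDomain A]
    [Algebra k A] [Algebra.FiniteType k A] [CommRing L] [IsDomain L] [Algebra k L] [Algebra A L]
    [IsScalarTower k A L] [FaithfulSMul A L] [Algebra.IsAlgebraic A L] {x : ι → L}
    (hx : IsTranscendenceBasis k x) :
    ringKrullDim A = ((Cardinal.toENat #ι : ℕ∞) : WithBot ℕ∞) := by
  obtain ⟨s, g, hg, hint⟩ := exists_integral_inj_algHom_of_fg k A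
  algebraize [g.toRingHom]
  have : IsScalarTower k (MvPolynomial (Fin s) k) A := .of_algebraMap_eq fun r ↦ (g.commutes r).symm
  have : FaithfulSMul (MvPolynomial (Fin s) k) A := (faithfulSMul_iff_algebraMap_injective _ _).2 hg
  have : Algebra.IsIntegral (MvPolynomial (Fin s) k) A := ⟨hint⟩
  have hX := ((IsTranscendenceBasis.mvPolynomial (Fin s) k).algebraMap_comp (A := A)).algebraMap_comp
    (A := L)
  have hcard := congrArg Cardinal.toENat (hx.lift_cardinalMk_eq hX)
  simp only [Cardinal.toENat_lift] at hcard
  rw [hcard, ← ringKrullDim_eq_of_isIntegral (MvPolynomial (Fin s) k) A,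
    MvPolynomial.ringKrullDim_of_isNoetherianRing]
  simp

/-- Inverting a nonzero element of an affine domain preserves the Krull dimension. -/
theorem ringKrullDim_localizationAway_eq (k : Type*) {A : Type*} [Field k] [CommRing A] [IsDomain A]
    [Algebra k A] [Algebra.FiniteType k A] {b : A} (hb : b ≠ 0) :
    ringKrullDim (Localization.Away b) = ringKrullDim A := by
  have hle : Submonoid.powers b ≤ nonZeroDivisors A :=
    powers_le_nonZeroDivisors_of_noZeroDivisors hb
  have : IsDomain (Localization.Away b) := IsLocalization.isDomain_localization hle
  have : FaithfulSMul A (Localization.Away b) :=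
    (faithfulSMul_iff_algebraMap_injective _ _).2 (IsLocalization.injective _ hle)
  have : Algebra.IsAlgebraic A (Localization.Away b) :=
    IsLocalization.isAlgebraic _ (Submonoid.powers b)
  obtain ⟨s, hs⟩ := exists_isTranscendenceBasis k A
  have hs' := hs.algebraMap_comp (A := Localization.Away b)
  rw [hs'.ringKrullDim_eq (A := A), hs'.ringKrullDim_eq (A := Localization.Away b)]

/-- If the localizations of `R` and `S` at `n` agree, then each element of `S` is a fraction of
elements of `R` whose denominator is not in `n`. -/
theorem exists_mul_mem_of_locSet_eq {S : Type*} [CommRing S] [IsDomain S] {R : Subring S}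
    {n : Ideal S} (hn : n ≠ ⊤)
    (h : locSet ((algebraMap S (FractionRing S)).comp R.subtype) (n.comap R.subtype)
      = locSet (algebraMap S (FractionRing S)) n) (s : S) :
    ∃ c ∈ R, c ∉ n ∧ s * c ∈ R := by
  have hs : algebraMap S (FractionRing S) s ∈ locSet (algebraMap S (FractionRing S)) n :=
    ⟨s, 1, (Ideal.ne_top_iff_one n).1 hn, by simp⟩
  rw [← h] at hs
  obtain ⟨a, b, hb, hab⟩ := hs
  refine ⟨b, b.2, hb, ?_⟩
  have : s * b = a := IsFractionRing.injective S (FractionRing S) (by simpa using hab)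
  exact this ▸ a.2

/-- If `S` is of finite type and each of its elements is a fraction of elements of `R` with
denominator outside the prime `n`, then powers of a single such denominator suffice. -/
theorem exists_forall_mul_pow_mem {k S : Type*} [CommRing k] [CommRing S] [Algebra k S]
    [Algebra.FiniteType k S] (R : Subalgebra k S) (n : Ideal S) [n.IsPrime]
    (h : ∀ s : S, ∃ c ∈ R, c ∉ n ∧ s * c ∈ R) :
    ∃ b ∈ R, b ∉ n ∧ ∀ s : S, ∃ N : ℕ, s * b ^ N ∈ R := by
  classical
  choose c hcR hcn hc using h
  obtain ⟨t, ht⟩ := ‹Algebra.FiniteType k S›.out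
  have hbR : ∏ i ∈ t, c i ∈ R := prod_mem fun i _ ↦ hcR i
  refine ⟨∏ i ∈ t, c i, hbR, ?_, fun s ↦ ?_⟩
  · rw [Ideal.IsPrime.prod_mem_iff]
    rintro ⟨i, -, hi⟩
    exact hcn i hi
  have hs : s ∈ Algebra.adjoin k (t : Set S) := ht ▸ Algebra.mem_top
  induction hs using Algebra.adjoin_induction with
  | mem s hs =>
    refine ⟨1, ?_⟩
    rw [pow_one, ← Finset.mul_prod_erase t c hs, ← mul_assoc]
    exact mul_mem (hc s) (prod_mem fun i _ ↦ hcR i)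
  | algebraMap r => exact ⟨0, by simp⟩
  | add x y _ _ hx hy =>
    obtain ⟨N, hN⟩ := hx
    obtain ⟨M, hM⟩ := hy
    refine ⟨N + M, ?_⟩
    convert add_mem (mul_mem hN (pow_mem hbR M)) (mul_mem hM (pow_mem hbR N)) using 1
    ring
  | mul x y _ _ hx hy =>
    obtain ⟨N, hN⟩ := hx
    obtain ⟨M, hM⟩ := hy
    refine ⟨N + M, ?_⟩
    convert mul_mem hN hM using 1
    ring

/-- If `S` becomes equal to `R` after inverting `b`, then inclusions between primes of `S` avoiding
`b` can be tested on `R`. -/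
theorem Ideal.le_of_comap_subtype_le {S : Type*} [CommRing S] {R : Subring S} {b : S}
    (h : ∀ s : S, ∃ N : ℕ, s * b ^ N ∈ R) {q q' : Ideal S} [q'.IsPrime] (hb : b ∉ q')
    (hle : q.comap R.subtype ≤ q'.comap R.subtype) : q ≤ q' := by
  intro s hs
  obtain ⟨N, hN⟩ := h s
  have : s * b ^ N ∈ q' := hle (x := ⟨_, hN⟩) (Ideal.mul_mem_right _ _ hs)
  exact (Ideal.IsPrime.mem_or_mem ‹_› this).resolve_right
    fun hbN ↦ hb (Ideal.IsPrime.mem_of_pow_mem ‹_› _ hbN)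

/-- If `S` is a depiction of `R` (`U ≠ ∅` and `Max S → Max R` surjective), then
`dim_S R = trdeg_k Frac R = dim S`, where `dim_S R` is the supremum of lengths of chains
of distinct primes of `R` that lift to chains of primes of `S`. -/
theorem stmt_18 {k S : Type*} [Field k] [IsAlgClosed k] [CommRing S] [IsDomain S]
    [Algebra k S] [Algebra.FiniteType k S] (R : Subalgebra k S)
    (hU : ∃ n : Ideal S, n.IsMaximal ∧
      locSet ((algebraMap S (FractionRing S)).comp R.toSubring.subtype)
          (n.comap R.toSubring.subtype)
        = locSet (algebraMap S (FractionRing S)) n)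
    (hsurj : ∀ m : Ideal R, m.IsMaximal → ∃ n : Ideal S, n.IsMaximal ∧
      n.comap R.toSubring.subtype = m)
    (dimSR : WithBot ℕ∞)
    (hdim : dimSR = sSup ((fun d : ℕ => (d : WithBot ℕ∞)) ''
      {d : ℕ | ∃ (p : Fin (d + 1) → Ideal R) (q : Fin (d + 1) → Ideal S),
        StrictMono p ∧ (∀ i, (p i).IsPrime) ∧ Monotone q ∧ (∀ i, (q i).IsPrime) ∧
        ∀ i, (q i).comap R.toSubring.subtype = p i})) :
    dimSR = ringKrullDim S ∧
    ∀ (ι : Type) (x : ι → FractionRing R), IsTranscendenceBasis k x →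
      ringKrullDim S = ((Cardinal.toENat (Cardinal.mk ι) : ℕ∞) : WithBot ℕ∞) := by
  obtain ⟨n, hn, hloc⟩ := hU
  have hfrac := exists_mul_mem_of_locSet_eq hn.ne_top hloc
  obtain ⟨b, hbR, hbn, hb⟩ := exists_forall_mul_pow_mem R n hfrac
  refine ⟨le_antisymm ?_ ?_, fun ι x hx ↦ ?_⟩
  · rw [hdim]
    refine sSup_le ?_
    rintro _ ⟨d, ⟨p, q, hp, -, hq, hqp, hpq⟩, rfl⟩
    have hq' : StrictMono fun i ↦ (⟨q i, hqp i⟩ : PrimeSpectrum S) := by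
      refine Monotone.strictMono_of_injective hq fun i j hij ↦ hp.injective ?_
      rw [← hpq, ← hpq, show q i = q j from congrArg PrimeSpectrum.asIdeal hij]
    exact Order.LTSeries.length_le_krullDim (LTSeries.mk d _ hq')
  · have hb0 : b ≠ 0 := fun h ↦ hbn (h ▸ n.zero_mem)
    rw [← ringKrullDim_localizationAway_eq k hb0, hdim]
    refine iSup_le fun l ↦ le_sSup ⟨l.length, ?_, rfl⟩
    let q (i : Fin (l.length + 1)) : Ideal S :=
      (l i).asIdeal.comap (algebraMap S (Localization.Away b))
    have hqp (i) : (q i).IsPrime := inferInstance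
    have hbq (i) : b ∉ q i := fun h ↦ (l i).isPrime.ne_top <|
      Ideal.eq_top_of_isUnit_mem _ h (IsLocalization.Away.algebraMap_isUnit b)
    have hq : StrictMono q := fun i j hij ↦
      (IsLocalization.orderEmbedding (Submonoid.powers b) (Localization.Away b)).strictMono
        (l.strictMono hij)
    refine ⟨fun i ↦ (q i).comap R.toSubring.subtype, q, fun i j hij ↦ ?_, fun i ↦ ?_, hq.monotone,
      hqp, fun i ↦ rfl⟩
    · refine ⟨Ideal.comap_mono (hq hij).le, fun h ↦ ?_⟩
      exact (hq hij).not_ge (Ideal.le_of_comap_subtype_le hb (hbq i) h)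
    · exact Ideal.IsPrime.comap _
  · have : Algebra.IsAlgebraic R S := ⟨fun s ↦ by
      obtain ⟨c, hcR, hcn, hsc⟩ := hfrac s
      have hc : (⟨c, hcR⟩ : R) ≠ 0 := fun h ↦
        hcn ((show c = 0 from congrArg Subtype.val h) ▸ n.zero_mem)
      refine ⟨.C ⟨c, hcR⟩ * .X - .C ⟨s * c, hsc⟩, fun h ↦ hc ?_, ?_⟩
      · simpa using congrArg (Polynomial.coeff · 1) h
      · simp [mul_comm s, Algebra.algebraMap_eq_smul_one, Subalgebra.smul_def]⟩
    have : Algebra.IsAlgebraic S (FractionRing S) :=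
      IsLocalization.isAlgebraic _ (nonZeroDivisors S)
    have : Algebra.IsAlgebraic R (FractionRing S) := .trans _ S _
    have : FaithfulSMul R (FractionRing S) := .trans R S _
    let := FractionRing.liftAlgebra R (FractionRing S)
    have : Algebra.IsAlgebraic (FractionRing R) (FractionRing S) :=
      .extendScalars (IsFractionRing.injective R (FractionRing R))
    have : FaithfulSMul (FractionRing R) (FractionRing S) :=
      (faithfulSMul_iff_algebraMap_injective _ _).2 (RingHom.injective _)
    have : IsScalarTower k (FractionRing R) (FractionRing S) := .to₁₃₄ k R _ _
    exact (hx.algebraMap_comp (A := FractionRing S)).ringKrullDim_eq (A := S)
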